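/- arXiv:1609.00234 — 3 statements merged into one kernel-verified Lean document; each statement's English description precedes it below -/
import Mathlib

section
/- Let f : [0,∞) → ℝ be a function of at most exponential growth (there exist A, B > 0 with |f(t)| ≤ A·e^{B t} for all t ≥ 0) and let x, y ≥ 0. Then ∑_{i=0}^{∞} ∑_{j=0}^{∞} [s_i(x) s_j(x) + s_i(y) s_j(y) − 2 s_i(x) s_j(y)] · f(i+j) = ∑_{k=0}^{∞} f(k) · (1/k!) · [(d/dz)^k (e^{xz} − e^{yz})^2] evaluated at z = −1. -/
/-- Mirakyan–Favard–Szász basis functions: `s_ν(x) = e^{-x} x^ν / ν!`. -/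
noncomputable def szaszBasis (ν : ℕ) (x : ℝ) : ℝ :=
  Real.exp (-x) * x ^ ν / (Nat.factorial ν : ℝ)

theorem summable_szaszBasis_mul_exp (a B : ℝ) :
    Summable fun i : ℕ => szaszBasis i a * Real.exp (B * i) := by
  refine ((Real.summable_pow_div_factorial (a * Real.exp B)).mul_left (Real.exp (-a))).congr
    fun i => ?_
  rw [szaszBasis, mul_pow, ← Real.exp_nat_mul, mul_comm B]
  ring

theorem szaszBasis_nonneg (i : ℕ) {a : ℝ} (ha : 0 ≤ a) : 0 ≤ szaszBasis i a := by
  unfold szaszBasis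
  positivity

theorem summable_szaszBasis_mul_szaszBasis {f : ℝ → ℝ} {A B : ℝ}
    (hf : ∀ t : ℝ, 0 ≤ t → |f t| ≤ A * Real.exp (B * t)) {a b : ℝ} (ha : 0 ≤ a) (hb : 0 ≤ b) :
    Summable fun p : ℕ × ℕ =>
      szaszBasis p.1 a * szaszBasis p.2 b * f (p.1 + p.2 : ℕ) := by
  have h := (Summable.mul_of_nonneg (summable_szaszBasis_mul_exp a B)
    (summable_szaszBasis_mul_exp b B)
    (fun i => mul_nonneg (szaszBasis_nonneg i ha) (Real.exp_nonneg _))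
    (fun i => mul_nonneg (szaszBasis_nonneg i hb) (Real.exp_nonneg _))).mul_left A
  refine h.of_norm_bounded fun p => ?_
  have h0 := mul_nonneg (szaszBasis_nonneg p.1 ha) (szaszBasis_nonneg p.2 hb)
  rw [Real.norm_eq_abs, abs_mul, abs_of_nonneg h0]
  refine (mul_le_mul_of_nonneg_left (hf _ (Nat.cast_nonneg _)) h0).trans_eq ?_
  rw [Nat.cast_add, mul_add, Real.exp_add]
  ring

/-- The Szász basis functions satisfy the convolution identity of Poisson weights. -/
theorem sum_antidiagonal_szaszBasis (a b : ℝ) (n : ℕ) :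
    ∑ p ∈ Finset.HasAntidiagonal.antidiagonal n, szaszBasis p.1 a * szaszBasis p.2 b
      = szaszBasis n (a + b) := by
  rw [szaszBasis, (Commute.all a b).add_pow', Finset.mul_sum, Finset.sum_div]
  refine Finset.sum_congr rfl fun p hp => ?_
  rw [Finset.HasAntidiagonal.mem_antidiagonal] at hp
  subst hp
  have h : ((p.1 + p.2).choose p.1 : ℝ) * p.1.factorial * p.2.factorial
      = (p.1 + p.2).factorial := by
    exact_mod_cast Nat.choose_symm_add (a := p.1) (b := p.2) ▸
      Nat.add_choose_mul_factorial_mul_factorial p.1 p.2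
  rw [← h, szaszBasis, szaszBasis, neg_add, Real.exp_add, nsmul_eq_mul]
  have hc : ((p.1 + p.2).choose p.1 : ℝ) ≠ 0 := by
    exact_mod_cast (Nat.choose_pos (Nat.le_add_right _ _)).ne'
  field_simp

theorem tsum_tsum_eq_tsum_sum_antidiagonal {F : ℕ × ℕ → ℝ} (hF : Summable F) :
    ∑' i, ∑' j, F (i, j) = ∑' n, ∑ p ∈ Finset.HasAntidiagonal.antidiagonal n, F p := by
  have hs := (Finset.HasAntidiagonal.sigmaAntidiagonalEquivProd (A := ℕ)).summable_iff.mpr hF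
  rw [← hF.tsum_prod, ← (Finset.HasAntidiagonal.sigmaAntidiagonalEquivProd (A := ℕ)).tsum_eq F]
  refine hs.tsum_sigma.trans (tsum_congr fun n => ?_)
  rw [tsum_fintype]
  exact Finset.sum_coe_sort (Finset.HasAntidiagonal.antidiagonal n) F

theorem iteratedDeriv_sq_exp_sub_exp (x y : ℝ) (k : ℕ) :
    1 / (Nat.factorial k : ℝ) *
        iteratedDeriv k (fun z : ℝ => (Real.exp (x * z) - Real.exp (y * z)) ^ 2) (-1)
      = szaszBasis k (x + x) + szaszBasis k (y + y) - 2 * szaszBasis k (x + y) := by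
  have he : (fun z : ℝ => (Real.exp (x * z) - Real.exp (y * z)) ^ 2)
      = fun z => Real.exp ((x + x) * z) + Real.exp ((y + y) * z)
        - 2 * Real.exp ((x + y) * z) := by
    ext z
    simp only [add_mul, Real.exp_add]
    ring
  have hc (c : ℝ) : ContDiffAt ℝ k (fun z : ℝ => Real.exp (c * z)) (-1) := by fun_prop
  rw [he, iteratedDeriv_fun_sub ((hc _).add (hc _)) (contDiffAt_const.mul (hc _)),
    iteratedDeriv_fun_add (hc _) (hc _), iteratedDeriv_const_mul_field]
  simp only [iteratedDeriv_exp_const_mul, szaszBasis, mul_neg_one]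
  ring

theorem szasz_double_sum_eq (f : ℝ → ℝ)
    (hf_growth : ∃ A B : ℝ, 0 < A ∧ 0 < B ∧ ∀ t : ℝ, 0 ≤ t → |f t| ≤ A * Real.exp (B * t))
    (x y : ℝ) (hx : 0 ≤ x) (hy : 0 ≤ y) :
    ∑' (i : ℕ), ∑' (j : ℕ),
      (szaszBasis i x * szaszBasis j x + szaszBasis i y * szaszBasis j y
        - 2 * szaszBasis i x * szaszBasis j y) * f (i + j : ℕ)
    = ∑' (k : ℕ), f k * (1 / (Nat.factorial k : ℝ)) *
        iteratedDeriv k (fun z : ℝ => (Real.exp (x * z) - Real.exp (y * z)) ^ 2) (-1) := by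
  obtain ⟨A, B, -, -, hf⟩ := hf_growth
  have hF : Summable fun p : ℕ × ℕ =>
      (szaszBasis p.1 x * szaszBasis p.2 x + szaszBasis p.1 y * szaszBasis p.2 y
        - 2 * szaszBasis p.1 x * szaszBasis p.2 y) * f (p.1 + p.2 : ℕ) := by
    refine (((summable_szaszBasis_mul_szaszBasis hf hx hx).add
      (summable_szaszBasis_mul_szaszBasis hf hy hy)).sub
      ((summable_szaszBasis_mul_szaszBasis hf hx hy).mul_left 2)).congr fun p => ?_
    ring
  refine (tsum_tsum_eq_tsum_sum_antidiagonal hF).trans (tsum_congr fun k => ?_)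
  rw [mul_assoc, iteratedDeriv_sq_exp_sub_exp, ← sum_antidiagonal_szaszBasis,
    ← sum_antidiagonal_szaszBasis, ← sum_antidiagonal_szaszBasis, Finset.mul_sum,
    ← Finset.sum_add_distrib, ← Finset.sum_sub_distrib, Finset.mul_sum]
  refine Finset.sum_congr rfl fun p hp => ?_
  rw [Finset.HasAntidiagonal.mem_antidiagonal.mp hp]
  ring
end

section
/- Let f : [0,∞) → ℝ be a function of at most exponential growth (there exist A, B > 0 with |f(t)| ≤ A·e^{B t} for all t ≥ 0) and let x, y ≥ 0. Define g : ℝ → ℝ by g(z) = ((e^{xz} − e^{yz})/z)^2 for z ≠ 0 and g(0) = (x−y)^2. Then ∑_{i=0}^{∞} ∑_{j=0}^{∞} [s_i(x) s_j(x) + s_i(y) s_j(y) − 2 s_i(x) s_j(y)] · f(i+j) = ∑_{k=0}^{∞} (Δ²f(k)) · (1/k!) · g^{(k)}(−1), where Δ²f(k) = f(k+2) − 2 f(k+1) + f(k). -/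
open Finset PowerSeries in
/-- A real power series converging absolutely everywhere. -/
def EntireCoeff (φ : PowerSeries ℝ) : Prop :=
  ∀ r : ℝ, Summable fun n => ‖coeff n φ * r ^ n‖

/-- A real sequence of at most geometric growth. -/
def GeomBounded (a : ℕ → ℝ) : Prop :=
  ∃ A r : ℝ, 0 ≤ r ∧ ∀ n, |a n| ≤ A * r ^ n

namespace EntireCoeff

open Finset PowerSeries

variable {φ ψ : PowerSeries ℝ}

lemma summable_mul (hφ : EntireCoeff φ) {a : ℕ → ℝ} (ha : GeomBounded a) :
    Summable fun n => ‖coeff n φ * a n‖ := by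
  obtain ⟨A, r, hr, hA⟩ := ha
  refine Summable.of_nonneg_of_le (fun n => norm_nonneg _) (fun n => ?_) ((hφ r).mul_left A)
  have h0 : 0 ≤ r ^ n := pow_nonneg hr n
  rw [norm_mul, norm_mul, Real.norm_of_nonneg h0, Real.norm_eq_abs (a n)]
  calc _ ≤ ‖coeff n φ‖ * (A * r ^ n) := by gcongr; exact hA n
    _ = _ := by ring

lemma coeff_mul_mul_pow (φ ψ : PowerSeries ℝ) (r : ℝ) (n : ℕ) :
    coeff n (φ * ψ) * r ^ n =
      ∑ p ∈ antidiagonal n, (coeff p.1 φ * r ^ p.1) * (coeff p.2 ψ * r ^ p.2) := by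
  rw [coeff_mul, sum_mul]
  refine sum_congr rfl fun p hp => ?_
  rw [← mem_antidiagonal.mp hp, pow_add]
  ring

lemma mul (hφ : EntireCoeff φ) (hψ : EntireCoeff ψ) : EntireCoeff (φ * ψ) := fun r =>
  (summable_norm_sum_mul_antidiagonal_of_summable_norm (hφ r) (hψ r)).congr fun n => by
    rw [coeff_mul_mul_pow]

lemma tsum_mul (hφ : EntireCoeff φ) (hψ : EntireCoeff ψ) (r : ℝ) :
    ∑' n, coeff n (φ * ψ) * r ^ n = (∑' n, coeff n φ * r ^ n) * ∑' n, coeff n ψ * r ^ n := by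
  simp_rw [coeff_mul_mul_pow]
  exact (tsum_mul_tsum_eq_tsum_sum_antidiagonal_of_summable_norm (hφ r) (hψ r)).symm

lemma sub (hφ : EntireCoeff φ) (hψ : EntireCoeff ψ) : EntireCoeff (φ - ψ) := fun r => by
  refine Summable.of_nonneg_of_le (fun n => norm_nonneg _) (fun n => ?_) ((hφ r).add (hψ r))
  rw [map_sub, sub_mul]
  exact norm_sub_le _ _

lemma tsum_sub (hφ : EntireCoeff φ) (hψ : EntireCoeff ψ) (r : ℝ) :
    ∑' n, coeff n (φ - ψ) * r ^ n = (∑' n, coeff n φ * r ^ n) - ∑' n, coeff n ψ * r ^ n := by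
  simp_rw [map_sub, sub_mul]
  exact (hφ r).of_norm.tsum_sub (hψ r).of_norm

lemma one : EntireCoeff 1 := fun r =>
  summable_of_ne_finset_zero (s := {0}) fun n hn => by
    simp [coeff_one, show n ≠ 0 by simpa using hn]

lemma X : EntireCoeff PowerSeries.X := fun r =>
  summable_of_ne_finset_zero (s := {1}) fun n hn => by
    simp [coeff_X, show n ≠ 1 by simpa using hn]

lemma tsum_one_sub_X (r : ℝ) : ∑' n, coeff n (1 - PowerSeries.X : PowerSeries ℝ) * r ^ n = 1 - r := by
  rw [tsum_sub one X, tsum_eq_single 0 (fun n hn => by simp [coeff_one, hn]),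
    tsum_eq_single 1 (fun n hn => by simp [coeff_X, hn])]
  simp

/-- Dividing by `1 - X` preserves entirety when the sum at `1` vanishes. -/
lemma mk_one_mul (hφ : EntireCoeff φ) (h : ∑' n, coeff n φ = 0) :
    EntireCoeff (PowerSeries.mk 1 * φ) := fun r => by
  set ρ := max 1 |r| with hρ
  have hρ1 : 1 ≤ ρ := le_max_left _ _
  have hs := hφ (2 * ρ)
  have hs1 : Summable fun n => coeff n φ := by simpa using (hφ 1).of_norm
  have hc : ∀ n, coeff n (PowerSeries.mk 1 * φ) = -∑' i, coeff (i + (n + 1)) φ := fun n => by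
    have h1 := hs1.sum_add_tsum_nat_add (n + 1)
    have h2 : coeff n (PowerSeries.mk 1 * φ) = ∑ i ∈ range (n + 1), coeff i φ := by
      rw [mul_comm, coeff_mul, Nat.sum_antidiagonal_eq_sum_range_succ_mk]
      simp
    linarith
  refine Summable.of_nonneg_of_le (fun n => norm_nonneg _) (fun n => ?_)
    (summable_geometric_two.mul_left (∑' i, ‖coeff i φ * (2 * ρ) ^ i‖))
  have hsn := (summable_nat_add_iff (n + 1)).2 hs
  have hs1n := (summable_nat_add_iff (n + 1)).2 hs1.norm
  have key : ∀ i, ‖coeff (i + (n + 1)) φ‖ * (2 * ρ) ^ n ≤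
      ‖coeff (i + (n + 1)) φ * (2 * ρ) ^ (i + (n + 1))‖ := fun i => by
    rw [norm_mul, Real.norm_of_nonneg (by positivity : 0 ≤ (2 * ρ) ^ (i + (n + 1)))]
    gcongr
    · linarith
    · omega
  have h3 : (∑' i, ‖coeff (i + (n + 1)) φ‖) * (2 * ρ) ^ n ≤ ∑' i, ‖coeff i φ * (2 * ρ) ^ i‖ := by
    rw [← tsum_mul_right]
    refine ((hs1n.mul_right _).tsum_le_tsum key hsn).trans ?_
    rw [← hs.sum_add_tsum_nat_add (n + 1)]
    exact le_add_of_nonneg_left (sum_nonneg fun _ _ => norm_nonneg _)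
  rw [hc, norm_mul, norm_neg, norm_pow, Real.norm_eq_abs r]
  calc _ ≤ (∑' i, ‖coeff (i + (n + 1)) φ‖) * ρ ^ n := by
        gcongr
        · exact norm_tsum_le_tsum_norm hs1n
        · exact le_max_right _ _
    _ = (∑' i, ‖coeff (i + (n + 1)) φ‖) * (2 * ρ) ^ n * (1 / 2) ^ n := by
        rw [mul_pow, one_div, inv_pow]; field_simp
    _ ≤ _ := by gcongr

end EntireCoeff

lemma GeomBounded.sub_succ {a : ℕ → ℝ} (ha : GeomBounded a) :
    GeomBounded fun n => a n - a (n + 1) := by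
  obtain ⟨A, r, hr, hA⟩ := ha
  refine ⟨A * (1 + r), r, hr, fun n => ?_⟩
  calc _ ≤ |a n| + |a (n + 1)| := abs_sub _ _
    _ ≤ A * r ^ n + A * r ^ (n + 1) := add_le_add (hA n) (hA (n + 1))
    _ = _ := by ring

open PowerSeries in
/-- Summation by parts for entire coefficients against a sequence of geometric growth. -/
lemma EntireCoeff.tsum_one_sub_X_mul {φ : PowerSeries ℝ} (hφ : EntireCoeff φ) {a : ℕ → ℝ}
    (ha : GeomBounded a) :
    ∑' n, coeff n ((1 - PowerSeries.X) * φ) * a n = ∑' n, coeff n φ * (a n - a (n + 1)) := by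
  have h1 := (hφ.summable_mul ha).of_norm
  have h2 := (((EntireCoeff.one.sub EntireCoeff.X).mul hφ).summable_mul ha).of_norm
  have h3 : Summable fun n => coeff n φ * a (n + 1) :=
    (h1.sub (hφ.summable_mul ha.sub_succ).of_norm).congr fun n => by ring
  have h4 : ∀ n, coeff (n + 1) ((1 - PowerSeries.X) * φ) * a (n + 1) =
      coeff (n + 1) φ * a (n + 1) - coeff n φ * a (n + 1) := fun n => by
    rw [sub_mul, one_mul, map_sub, coeff_succ_X_mul, sub_mul]
  rw [h2.tsum_eq_zero_add]
  simp_rw [h4, mul_sub]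
  rw [((summable_nat_add_iff 1).2 h1).tsum_sub h3, h1.tsum_sub h3, h1.tsum_eq_zero_add]
  simp [sub_mul]
  ring

open PowerSeries in
/-- The generating function of the Szász basis at `x`. -/
noncomputable def szaszSeries (x : ℝ) : PowerSeries ℝ := PowerSeries.mk fun n => szaszBasis n x

open PowerSeries in
lemma hasSum_szaszSeries (x r : ℝ) :
    HasSum (fun n => coeff n (szaszSeries x) * r ^ n) (Real.exp (x * (r - 1))) := by
  have h := (NormedSpace.expSeries_div_hasSum_exp (x * r)).mul_left (Real.exp (-x))
  rw [← Real.exp_eq_exp_ℝ, ← Real.exp_add] at h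
  rw [show x * (r - 1) = -x + x * r by ring]
  refine (congrArg (HasSum · _) (funext fun n => ?_)).mpr h
  simp only [szaszSeries, coeff_mk, szaszBasis, mul_pow]
  ring

lemma entireCoeff_szaszSeries (x : ℝ) : EntireCoeff (szaszSeries x) := fun r =>
  (hasSum_szaszSeries x r).summable.norm

open PowerSeries in
/-- The Taylor coefficients of a function that is locally a convergent power series. -/
lemma iteratedDeriv_eq_factorial_mul_coeff {g : ℝ → ℝ} {z : ℝ} {φ : PowerSeries ℝ}
    (h : ∀ᶠ w in nhds (0 : ℝ), HasSum (fun n => coeff n φ * w ^ n) (g (z + w))) (k : ℕ) :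
    1 / (Nat.factorial k : ℝ) * iteratedDeriv k g z = coeff k φ := by
  have hp : HasFPowerSeriesAt g (FormalMultilinearSeries.ofScalars ℝ fun n => coeff n φ) z := by
    rw [hasFPowerSeriesAt_iff]
    filter_upwards [h] with w hw
    simpa [FormalMultilinearSeries.coeff_ofScalars, mul_comm] using hw
  have hq := hp.analyticAt.hasFPowerSeriesAt
  have := congrArg (fun p => FormalMultilinearSeries.coeff p k) (hq.eq_formalMultilinearSeries hp)
  simp only [FormalMultilinearSeries.coeff_ofScalars] at this
  rw [← this]
  ring

open Finset PowerSeries in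
/-- Regrouping the Szász double sum along antidiagonals. -/
lemma tsum_tsum_szaszBasis {a : ℕ → ℝ} (ha : GeomBounded a) (x y : ℝ) :
    ∑' (i : ℕ), ∑' (j : ℕ), (szaszBasis i x * szaszBasis j x + szaszBasis i y * szaszBasis j y
        - 2 * szaszBasis i x * szaszBasis j y) * a (i + j) =
      ∑' n, coeff n ((szaszSeries x - szaszSeries y) * (szaszSeries x - szaszSeries y)) * a n := by
  obtain ⟨A, r, hr, hA⟩ := ha
  have hprod : ∀ u v : ℝ,
      Summable fun p : ℕ × ℕ => szaszBasis p.1 u * szaszBasis p.2 v * a (p.1 + p.2) := fun u v => by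
    refine Summable.of_norm_bounded (((entireCoeff_szaszSeries u r).mul_norm
      (entireCoeff_szaszSeries v r)).mul_left A) fun p => ?_
    have h1 : 0 ≤ r ^ p.1 := pow_nonneg hr _
    have h2 : 0 ≤ r ^ p.2 := pow_nonneg hr _
    simp only [szaszSeries, coeff_mk, norm_mul, Real.norm_of_nonneg h1, Real.norm_of_nonneg h2]
    calc _ ≤ ‖szaszBasis p.1 u‖ * ‖szaszBasis p.2 v‖ * (A * r ^ (p.1 + p.2)) := by
          gcongr; exact hA _
      _ = _ := by rw [pow_add]; ring
  have hF : Summable fun p : ℕ × ℕ => (szaszBasis p.1 x * szaszBasis p.2 x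
      + szaszBasis p.1 y * szaszBasis p.2 y - 2 * szaszBasis p.1 x * szaszBasis p.2 y)
        * a (p.1 + p.2) :=
    (((hprod x x).add (hprod y y)).sub ((hprod x y).mul_left 2)).congr fun p => by ring
  rw [← hF.tsum_prod, ← HasAntidiagonal.sigmaAntidiagonalEquivProd.tsum_eq]
  refine ((HasAntidiagonal.sigmaAntidiagonalEquivProd.summable_iff.mpr hF).tsum_sigma'
    fun n => (hasSum_fintype _).summable).trans ?_
  refine tsum_congr fun n => ?_
  rw [tsum_fintype]
  have hswap : (szaszSeries x - szaszSeries y) * (szaszSeries x - szaszSeries y) =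
      szaszSeries x * szaszSeries x + szaszSeries y * szaszSeries y
        - (2 : ℝ) • (szaszSeries x * szaszSeries y) := by
    rw [two_smul]; ring
  rw [hswap, map_sub, map_add, coeff_smul, coeff_mul, coeff_mul, coeff_mul]
  simp only [szaszSeries, coeff_mk]
  refine (Finset.sum_coe_sort (antidiagonal n) (fun p : ℕ × ℕ => (szaszBasis p.1 x * szaszBasis p.2 x
      + szaszBasis p.1 y * szaszBasis p.2 y - 2 * szaszBasis p.1 x * szaszBasis p.2 y)
        * a (p.1 + p.2))).trans ?_
  rw [smul_eq_mul, mul_sum, ← sum_add_distrib, ← sum_sub_distrib, sum_mul]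
  refine sum_congr rfl fun p hp => ?_
  rw [mem_antidiagonal.mp hp]
  ring

theorem szasz_key_identity (f : ℝ → ℝ)
    (hf_growth : ∃ A B : ℝ, 0 < A ∧ 0 < B ∧ ∀ t : ℝ, 0 ≤ t → |f t| ≤ A * Real.exp (B * t))
    (x y : ℝ) (hx : 0 ≤ x) (hy : 0 ≤ y)
    (g : ℝ → ℝ)
    (hg : ∀ z : ℝ, g z = if z = 0 then (x - y) ^ 2
        else ((Real.exp (x * z) - Real.exp (y * z)) / z) ^ 2) :
    ∑' (i : ℕ), ∑' (j : ℕ),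
      (szaszBasis i x * szaszBasis j x + szaszBasis i y * szaszBasis j y
        - 2 * szaszBasis i x * szaszBasis j y) * f (i + j : ℕ)
    = ∑' (k : ℕ), (f (k + 1 + 1 : ℕ) - 2 * f (k + 1 : ℕ) + f (k : ℕ)) *
        (1 / (Nat.factorial k : ℝ)) * iteratedDeriv k g (-1) := by
  have ha : GeomBounded fun n : ℕ => f n := by
    obtain ⟨A, B, -, -, h⟩ := hf_growth
    refine ⟨A, Real.exp B, (Real.exp_pos B).le, fun n => ?_⟩
    rw [← Real.exp_nat_mul, mul_comm (n : ℝ)]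
    exact h n n.cast_nonneg
  rw [tsum_tsum_szaszBasis ha x y]
  set δ := szaszSeries x - szaszSeries y with hδ
  have hδe : EntireCoeff δ := (entireCoeff_szaszSeries x).sub (entireCoeff_szaszSeries y)
  have hδs : ∀ r : ℝ, ∑' n, PowerSeries.coeff n δ * r ^ n =
      Real.exp (x * (r - 1)) - Real.exp (y * (r - 1)) := fun r => by
    rw [hδ, (entireCoeff_szaszSeries x).tsum_sub (entireCoeff_szaszSeries y),
      (hasSum_szaszSeries x r).tsum_eq, (hasSum_szaszSeries y r).tsum_eq]
  set ε := PowerSeries.mk 1 * δ with hε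
  have hεe : EntireCoeff ε := hδe.mk_one_mul (by simpa using hδs 1)
  have hδε : δ = (1 - PowerSeries.X) * ε := by
    rw [hε, ← mul_assoc, mul_comm (1 - PowerSeries.X),
      PowerSeries.mk_one_mul_one_sub_eq_one, one_mul]
  have h1X : EntireCoeff (1 - PowerSeries.X) := EntireCoeff.one.sub EntireCoeff.X
  have hεεe : EntireCoeff (ε * ε) := hεe.mul hεe
  have hcoeff : ∀ k, 1 / (Nat.factorial k : ℝ) * iteratedDeriv k g (-1) =
      PowerSeries.coeff k (ε * ε) := by
    refine iteratedDeriv_eq_factorial_mul_coeff ?_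
    filter_upwards [eventually_ne_nhds (zero_ne_one' ℝ)] with w hw
    have hw1 : -1 + w ≠ 0 := fun h => hw (by linarith)
    have hmul := h1X.tsum_mul hεe w
    rw [← hδε, hδs, EntireCoeff.tsum_one_sub_X] at hmul
    have hval : g (-1 + w) = ∑' n, PowerSeries.coeff n (ε * ε) * w ^ n := by
      rw [hg, if_neg hw1, hεe.tsum_mul hεe, show -1 + w = w - 1 by ring, hmul, div_pow,
        div_eq_iff (pow_ne_zero 2 (sub_ne_zero.2 hw))]
      ring
    rw [hval]
    exact (hεεe w).of_norm.hasSum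
  have hsq : δ * δ = (1 - PowerSeries.X) * ((1 - PowerSeries.X) * (ε * ε)) := by
    rw [hδε]; ring
  rw [hsq, (h1X.mul hεεe).tsum_one_sub_X_mul ha, hεεe.tsum_one_sub_X_mul ha.sub_succ]
  refine tsum_congr fun k => ?_
  rw [← hcoeff]
  ring
end

section
/- Let n ≥ 1 be a natural number, let f : [0,∞) → ℝ be a function of at most polynomial growth (there exist A > 0 and m ∈ ℕ with |f(t)| ≤ A·(1+t)^m for all t ≥ 0), and let x, y ≥ 0. Then ∑_{i=0}^{∞} ∑_{j=0}^{∞} [b_{n,i}(x) b_{n,j}(x) + b_{n,i}(y) b_{n,j}(y) − 2 b_{n,i}(x) b_{n,j}(y)] · f(i+j) = ∑_{k=0}^{∞} f(k) · (1/k!) · [(d/dz)^k ((1−xz)^{−n} − (1−yz)^{−n})^2] evaluated at z = −1. -/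
/-- Baskakov basis functions: `b_{n,ν}(x) = C(n+ν-1, ν) x^ν / (1+x)^{n+ν}`. -/
noncomputable def baskakovBasis (n ν : ℕ) (x : ℝ) : ℝ :=
  ((n + ν - 1).choose ν : ℝ) * x ^ ν / (1 + x) ^ (n + ν)

theorem baskakovBasis_nonneg (n ν : ℕ) {x : ℝ} (hx : 0 ≤ x) : 0 ≤ baskakovBasis n ν x := by
  unfold baskakovBasis
  positivity

theorem iteratedDeriv_one_sub_mul_zpow_neg (n k : ℕ) (x : ℝ) :
    iteratedDeriv k (fun z : ℝ => (1 - x * z) ^ (-(n : ℤ))) =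
      fun z => (n.ascFactorial k : ℝ) * x ^ k * (1 - x * z) ^ (-((n + k : ℕ) : ℤ)) := by
  induction k with
  | zero => simp
  | succ k ih =>
    funext z
    rw [iteratedDeriv_succ, ih, deriv_const_mul_field,
      deriv_comp_mul_left x (fun w : ℝ => (1 - w) ^ (-((n + k : ℕ) : ℤ))) z,
      deriv_comp_const_sub (fun w : ℝ => w ^ (-((n + k : ℕ) : ℤ))), deriv_zpow,
      Nat.ascFactorial_succ, show -((n + k : ℕ) : ℤ) - 1 = -((n + (k + 1) : ℕ) : ℤ) by
        push_cast; ring]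
    push_cast
    simp only [smul_eq_mul]
    ring

theorem iteratedDeriv_one_sub_mul_zpow_neg_at_neg_one {n : ℕ} (hn : 1 ≤ n) (k : ℕ) (x : ℝ) :
    iteratedDeriv k (fun z : ℝ => (1 - x * z) ^ (-(n : ℤ))) (-1) =
      (k.factorial : ℝ) * baskakovBasis n k x := by
  obtain ⟨p, rfl⟩ := Nat.exists_eq_add_of_le' hn
  rw [iteratedDeriv_one_sub_mul_zpow_neg, baskakovBasis, Nat.ascFactorial_eq_factorial_mul_choose,
    show p + 1 + k - 1 = p + k by omega]
  simp only [zpow_neg, zpow_natCast, mul_neg, mul_one, sub_neg_eq_add]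
  push_cast
  ring

theorem contDiffAt_one_sub_mul_zpow_neg (n : ℕ) (m : WithTop ℕ∞) {x z : ℝ} (h : 1 - x * z ≠ 0) :
    ContDiffAt ℝ m (fun z : ℝ => (1 - x * z) ^ (-(n : ℤ))) z := by
  simp only [zpow_neg, zpow_natCast]
  exact ContDiffAt.inv (by fun_prop) (pow_ne_zero _ h)

theorem iteratedDeriv_sq_sub_at_neg_one {n : ℕ} (hn : 1 ≤ n) (k : ℕ) {x y : ℝ}
    (hx : 0 ≤ x) (hy : 0 ≤ y) :
    1 / (k.factorial : ℝ) * iteratedDeriv k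
      (fun z : ℝ => ((1 - x * z) ^ (-(n : ℤ)) - (1 - y * z) ^ (-(n : ℤ))) ^ 2) (-1) =
    ∑ p ∈ Finset.HasAntidiagonal.antidiagonal k, (baskakovBasis n p.1 x - baskakovBasis n p.1 y) *
      (baskakovBasis n p.2 x - baskakovBasis n p.2 y) := by
  have hcx (m : WithTop ℕ∞) := contDiffAt_one_sub_mul_zpow_neg n m (x := x) (z := -1) (by linarith)
  have hcy (m : WithTop ℕ∞) := contDiffAt_one_sub_mul_zpow_neg n m (x := y) (z := -1) (by linarith)
  simp only [sq]
  rw [iteratedDeriv_fun_mul ((hcx _).sub (hcy _)) ((hcx _).sub (hcy _)),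
    Finset.Nat.sum_antidiagonal_eq_sum_range_succ_mk, Finset.mul_sum]
  refine Finset.sum_congr rfl fun i hi => ?_
  have hik : i ≤ k := Nat.lt_succ_iff.mp (Finset.mem_range.mp hi)
  simp only [iteratedDeriv_fun_sub (hcx _) (hcy _),
    iteratedDeriv_one_sub_mul_zpow_neg_at_neg_one hn]
  have hfac : (k.factorial : ℝ) = k.choose i * i.factorial * (k - i).factorial := by
    exact_mod_cast (Nat.choose_mul_factorial_mul_factorial hik).symm
  have hk : (k.factorial : ℝ) ≠ 0 := by positivity
  field_simp
  rw [hfac]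
  ring

theorem one_add_pow_le_two_pow_mul (i k : ℕ) : (1 + (i : ℝ)) ^ k ≤ 2 ^ k * ((i : ℝ) ^ k + 1) := by
  rcases Nat.eq_zero_or_pos i with rfl | hi
  · have h₁ : (1 : ℝ) ≤ 2 ^ k := one_le_pow₀ (by norm_num)
    have h₂ : (0 : ℝ) ≤ (0 : ℝ) ^ k := by positivity
    simp only [Nat.cast_zero, add_zero, one_pow]
    nlinarith
  · have h : (1 : ℝ) ≤ i := by exact_mod_cast hi
    calc (1 + (i : ℝ)) ^ k ≤ (2 * i) ^ k := by gcongr; linarith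
      _ = 2 ^ k * (i : ℝ) ^ k := mul_pow _ _ _
      _ ≤ _ := by gcongr; linarith

theorem summable_one_add_pow_mul_geometric (k : ℕ) {r : ℝ} (hr : 0 ≤ r) (hr1 : r < 1) :
    Summable fun i : ℕ => (1 + (i : ℝ)) ^ k * r ^ i := by
  have hn : ‖r‖ < 1 := by rwa [Real.norm_of_nonneg hr]
  refine Summable.of_nonneg_of_le (fun i => by positivity) (fun i => ?_)
    (((summable_pow_mul_geometric_of_norm_lt_one k hn).add
      (summable_geometric_of_norm_lt_one hn)).mul_left (2 ^ k))
  calc (1 + (i : ℝ)) ^ k * r ^ i ≤ (2 ^ k * ((i : ℝ) ^ k + 1)) * r ^ i := by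
        gcongr
        exact one_add_pow_le_two_pow_mul i k
    _ = _ := by ring

theorem summable_baskakovBasis_mul_one_add_pow {n : ℕ} (hn : 1 ≤ n) (m : ℕ) {x : ℝ}
    (hx : 0 ≤ x) : Summable fun i : ℕ => baskakovBasis n i x * (1 + (i : ℝ)) ^ m := by
  obtain ⟨p, rfl⟩ := Nat.exists_eq_add_of_le' hn
  have hx1 : 0 < 1 + x := by linarith
  refine Summable.of_nonneg_of_le
    (fun i => mul_nonneg (baskakovBasis_nonneg _ _ hx) (by positivity)) (fun i => ?_)
    ((summable_one_add_pow_mul_geometric (p + m) (r := x / (1 + x)) (by positivity)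
      ((div_lt_one hx1).2 (by linarith))).mul_left ((p + 1 : ℝ) ^ p / (1 + x) ^ (p + 1)))
  have hchoose : ((p + i).choose i : ℝ) ≤ ((p + 1) * (1 + i)) ^ p := by
    rw [Nat.choose_symm_add.symm]
    calc ((p + i).choose p : ℝ) ≤ ((p + i : ℕ) : ℝ) ^ p := by
          exact_mod_cast Nat.choose_le_pow _ _
      _ ≤ _ := by
          gcongr
          push_cast
          nlinarith [(Nat.cast_nonneg p : (0 : ℝ) ≤ p), (Nat.cast_nonneg i : (0 : ℝ) ≤ i),
            mul_nonneg (Nat.cast_nonneg p : (0 : ℝ) ≤ p) (Nat.cast_nonneg i)]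
  calc baskakovBasis (p + 1) i x * (1 + (i : ℝ)) ^ m
      = ((p + i).choose i : ℝ) * x ^ i / (1 + x) ^ (p + 1 + i) * (1 + (i : ℝ)) ^ m := by
        rw [baskakovBasis, show p + 1 + i - 1 = p + i by omega]
    _ ≤ ((p + 1) * (1 + i)) ^ p * x ^ i / (1 + x) ^ (p + 1 + i) * (1 + (i : ℝ)) ^ m := by gcongr
    _ = _ := by
        rw [div_pow, mul_pow, pow_add (1 + x), pow_add (1 + (i : ℝ))]
        field_simp

theorem summable_baskakovBasis_mul_baskakovBasis_mul {n : ℕ} (hn : 1 ≤ n) {f : ℝ → ℝ}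
    (hf_growth : ∃ A : ℝ, ∃ m : ℕ, 0 < A ∧ ∀ t : ℝ, 0 ≤ t → |f t| ≤ A * (1 + t) ^ m)
    {u v : ℝ} (hu : 0 ≤ u) (hv : 0 ≤ v) :
    Summable fun p : ℕ × ℕ =>
      baskakovBasis n p.1 u * baskakovBasis n p.2 v * f (p.1 + p.2 : ℕ) := by
  obtain ⟨A, m, hA, hf⟩ := hf_growth
  have hnonneg (w : ℝ) (hw : 0 ≤ w) :
      0 ≤ fun i : ℕ => baskakovBasis n i w * (1 + (i : ℝ)) ^ m :=
    fun i => mul_nonneg (baskakovBasis_nonneg _ _ hw) (by positivity)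
  refine Summable.of_norm_bounded
    ((Summable.mul_of_nonneg (summable_baskakovBasis_mul_one_add_pow hn m hu)
      (summable_baskakovBasis_mul_one_add_pow hn m hv) (hnonneg u hu) (hnonneg v hv)).mul_left A)
    fun ⟨i, j⟩ => ?_
  have hbu := baskakovBasis_nonneg n i hu
  have hbv := baskakovBasis_nonneg n j hv
  have hfij : |f (i + j : ℕ)| ≤ A * ((1 + (i : ℝ)) * (1 + j)) ^ m := by
    refine (hf _ (Nat.cast_nonneg _)).trans ?_
    gcongr
    push_cast
    nlinarith [mul_nonneg (Nat.cast_nonneg i : (0 : ℝ) ≤ i) (Nat.cast_nonneg j)]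
  calc ‖baskakovBasis n i u * baskakovBasis n j v * f (i + j : ℕ)‖
      = baskakovBasis n i u * baskakovBasis n j v * |f (i + j : ℕ)| := by
        rw [norm_mul, Real.norm_of_nonneg (mul_nonneg hbu hbv), Real.norm_eq_abs]
    _ ≤ baskakovBasis n i u * baskakovBasis n j v * (A * ((1 + (i : ℝ)) * (1 + j)) ^ m) := by
        gcongr
    _ = _ := by
        rw [mul_pow]
        ring

theorem baskakov_double_sum_eq (n : ℕ) (hn : 1 ≤ n) (f : ℝ → ℝ)
    (hf_growth : ∃ A : ℝ, ∃ m : ℕ, 0 < A ∧ ∀ t : ℝ, 0 ≤ t → |f t| ≤ A * (1 + t) ^ m)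
    (x y : ℝ) (hx : 0 ≤ x) (hy : 0 ≤ y) :
    ∑' (i : ℕ), ∑' (j : ℕ),
      (baskakovBasis n i x * baskakovBasis n j x + baskakovBasis n i y * baskakovBasis n j y
        - 2 * baskakovBasis n i x * baskakovBasis n j y) * f (i + j : ℕ)
    = ∑' (k : ℕ), f k * (1 / (Nat.factorial k : ℝ)) *
        iteratedDeriv k
          (fun z : ℝ => ((1 - x * z) ^ (-(n : ℤ)) - (1 - y * z) ^ (-(n : ℤ))) ^ 2) (-1) := by
  have hxx := summable_baskakovBasis_mul_baskakovBasis_mul hn hf_growth hx hx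
  have hyy := summable_baskakovBasis_mul_baskakovBasis_mul hn hf_growth hy hy
  have hxy := summable_baskakovBasis_mul_baskakovBasis_mul hn hf_growth hx hy
  have hyx := summable_baskakovBasis_mul_baskakovBasis_mul hn hf_growth hy hx
  have hswap : ∑' p : ℕ × ℕ, baskakovBasis n p.1 y * baskakovBasis n p.2 x * f (p.1 + p.2 : ℕ) =
      ∑' p : ℕ × ℕ, baskakovBasis n p.1 x * baskakovBasis n p.2 y * f (p.1 + p.2 : ℕ) := by
    rw [← (Equiv.prodComm ℕ ℕ).tsum_eq]
    refine tsum_congr fun p => ?_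
    simp only [Equiv.prodComm_apply, Prod.fst_swap, Prod.snd_swap, add_comm p.2 p.1]
    ring
  have hL := (hxx.hasSum.add hyy.hasSum).sub (hxy.hasSum.mul_left 2)
  have hR := (hxx.hasSum.add hyy.hasSum).sub (hxy.hasSum.add hyx.hasSum)
  rw [hswap, ← two_mul] at hR
  have hL' : HasSum (fun p : ℕ × ℕ => (baskakovBasis n p.1 x * baskakovBasis n p.2 x +
      baskakovBasis n p.1 y * baskakovBasis n p.2 y -
      2 * baskakovBasis n p.1 x * baskakovBasis n p.2 y) * f (p.1 + p.2 : ℕ)) _ :=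
    hL.congr_fun fun p => by ring
  have hR' : HasSum (fun p : ℕ × ℕ => f (p.1 + p.2 : ℕ) *
      ((baskakovBasis n p.1 x - baskakovBasis n p.1 y) *
        (baskakovBasis n p.2 x - baskakovBasis n p.2 y))) _ :=
    hR.congr_fun fun p => by ring
  rw [← hL'.summable.tsum_prod, hL'.tsum_eq, ← hR'.tsum_eq,
    ← Finset.HasAntidiagonal.sigmaAntidiagonalEquivProd.tsum_eq]
  refine ((Finset.HasAntidiagonal.sigmaAntidiagonalEquivProd.summable_iff.2
    hR'.summable).tsum_sigma' fun k => (hasSum_fintype _).summable).trans ?_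
  refine tsum_congr fun k => ?_
  rw [mul_assoc, iteratedDeriv_sq_sub_at_neg_one hn k hx hy, Finset.mul_sum, tsum_fintype,
    ← Finset.sum_coe_sort (Finset.HasAntidiagonal.antidiagonal k)]
  refine Finset.sum_congr rfl fun p _ => ?_
  have hp : p.1.1 + p.1.2 = k := Finset.HasAntidiagonal.mem_antidiagonal.1 p.2
  simp only [Function.comp_apply, Finset.HasAntidiagonal.sigmaAntidiagonalEquivProd_apply, hp]
end
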